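/- Let A be a bialgebra over k (in Mathlib's sense), regarded as a comodule over itself via the coaction ρ = Δ (the right regular representation), and let C ⊆ A be a subcoalgebra containing the unit 1 of A. Then A_C = C; equivalently, {a ∈ A : Δ(a) ∈ A ⊗ C} = C. (Proposition 3.1(3) of the paper.) -/

import Mathlib

open TensorProduct

/-- The image in `M ⊗[k] A` of `N ⊗[k] X` under the tensor product of the inclusion maps. -/
noncomputable def tmulSub {k M A : Type*} [Field k] [AddCommMonoid M] [Module k M]
    [AddCommMonoid A] [Module k A] (N : Submodule k M) (X : Submodule k A) :
    Submodule k (M ⊗[k] A) :=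
  LinearMap.range (TensorProduct.map N.subtype X.subtype)

/-- `M_X`: the supremum of all `X`-subcomodules of `M`. -/
noncomputable def subMX {k M A : Type*} [Field k] [AddCommMonoid M] [Module k M]
    [AddCommMonoid A] [Module k A] (ρ : M →ₗ[k] M ⊗[k] A) (X : Submodule k A) :
    Submodule k M :=
  sSup {N : Submodule k M | ∀ n ∈ N, ρ n ∈ tmulSub N X}

/-- Proposition 3.1(3): if `A` is a bialgebra, regarded as a comodule over itself via
`ρ = Δ` (the right regular representation), and `C ⊆ A` is a subcoalgebra containing `1`,
then `A_C = C`; equivalently `{a : Δ a ∈ A ⊗ C} = C`. -/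
theorem stmt_7 {k A : Type*} [Field k] [Ring A] [Bialgebra k A]
    (C : Submodule k A)
    (hC : ∀ c ∈ C, Coalgebra.comul (R := k) c ∈ tmulSub C C)
    (h1 : (1 : A) ∈ C) :
    subMX (Coalgebra.comul (R := k) (A := A)) C = C ∧
    Submodule.comap (Coalgebra.comul (R := k) (A := A))
      (tmulSub (⊤ : Submodule k A) C) = C := by
  have key : ∀ (N : Submodule k A) (a : A),
      Coalgebra.comul (R := k) a ∈ tmulSub N C → a ∈ C := by
    intro N a ha
    have h : ∀ t ∈ tmulSub N C,
        TensorProduct.lid k A (LinearMap.rTensor A (Coalgebra.counit (R := k) (A := A)) t) ∈ C := by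
      rintro _ ⟨u, rfl⟩
      induction u using TensorProduct.induction_on with
      | zero => simp
      | tmul x y => simpa using C.smul_mem _ y.2
      | add x y hx hy => simpa only [map_add] using C.add_mem hx hy
    have h2 := h _ ha
    rw [Coalgebra.rTensor_counit_comul] at h2
    simpa using h2
  refine ⟨le_antisymm (sSup_le fun N hN a ha => key N a (hN a ha)) (le_sSup hC),
    le_antisymm (fun a ha => key ⊤ a ha) fun c hc => ?_⟩
  obtain ⟨u, hu⟩ := hC c hc
  refine ⟨TensorProduct.map (Submodule.inclusion le_top) LinearMap.id u, ?_⟩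
  rw [← hu, ← LinearMap.comp_apply, ← TensorProduct.map_comp]
  rfl
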